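/- Let a, b ∈ ℤ be nonzero with b odd and gcd(a, b) = 1, and write a = a₀·a₁ where a₁ > 0 is the odd part of |a| (so a₀ = ± a power of 2). Then J(a | |b|) · J(b | a₁) = h₂ · h∞, where J denotes the Jacobi symbol, h∞ = −1 if a < 0 and b < 0 and h∞ = 1 otherwise, and h₂ = 1 if the quaternion algebra ℍ[ℚ₂, a, b] is isomorphic as a ℚ₂-algebra to the 2×2 matrix algebra over ℚ₂ and h₂ = −1 otherwise. -/

import Mathlib

open Quaternion

open scoped NumberTheorySymbols Classical

section Split

variable {F : Type*} [Field F]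

/-- A nontrivial zero of `a * x ^ 2 + b * y ^ 2 = z ^ 2` with `z ≠ 0` makes `b` a norm from
`F(√a)`. -/
theorem exists_eq_sq_sub_mul_sq_of_isotropic (h2 : (2 : F) ≠ 0) {a b x y z : F} (hz : z ≠ 0)
    (h : a * x ^ 2 + b * y ^ 2 = z ^ 2) : ∃ p q : F, b = p ^ 2 - a * q ^ 2 := by
  by_cases hy : y = 0
  · subst hy
    have hx : x ≠ 0 := by
      rintro rfl
      exact hz (by simpa using h.symm)
    refine ⟨(b + 1) / 2, (b - 1) * x / (2 * z), ?_⟩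
    have : a = z ^ 2 / x ^ 2 := by field_simp; linear_combination h
    rw [this]
    field_simp
    ring
  · refine ⟨z / y, x / y, ?_⟩
    field_simp
    linear_combination h

/-- If `b` is a norm from `F(√a)` then the quaternion algebra `ℍ[F, a, b]` is split. -/
theorem QuaternionAlgebra.nonempty_algEquiv_matrix (h2 : (2 : F) ≠ 0) {a b : F} (ha : a ≠ 0)
    (hb : b ≠ 0) (h : ∃ p q : F, b = p ^ 2 - a * q ^ 2) :
    Nonempty (ℍ[F, a, b] ≃ₐ[F] Matrix (Fin 2) (Fin 2) F) := by
  obtain ⟨p, q, h⟩ := h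
  let B : QuaternionAlgebra.Basis (Matrix (Fin 2) (Fin 2) F) a 0 b :=
    { i := !![0, a; 1, 0]
      j := !![p, -(a * q); q, -p]
      k := !![a * q, -(a * p); p, -(a * q)]
      i_mul_i := by
        ext i j; fin_cases i <;> fin_cases j <;> simp
      j_mul_j := by
        ext i j; fin_cases i <;> fin_cases j <;> simp [h] <;> ring
      i_mul_j := by
        ext i j; fin_cases i <;> fin_cases j <;> simp
      j_mul_i := by
        ext i j; fin_cases i <;> fin_cases j <;> simp <;> ring }
  have hinj : Function.Injective B.liftHom := by
    rw [injective_iff_map_eq_zero]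
    rintro ⟨w, x, y, z⟩ h0
    have h1 : B.lift ⟨w, x, y, z⟩ = 0 := h0
    have e00 := congrFun (congrFun h1 0) 0
    have e01 := congrFun (congrFun h1 0) 1
    have e10 := congrFun (congrFun h1 1) 0
    have e11 := congrFun (congrFun h1 1) 1
    simp [QuaternionAlgebra.Basis.lift, B, Algebra.algebraMap_eq_smul_one] at e00 e01 e10 e11
    have hw : w = 0 := by
      apply mul_left_cancel₀ h2
      linear_combination e00 + e11
    have hx : x = 0 := by
      apply mul_left_cancel₀ (mul_ne_zero h2 ha)
      linear_combination e01 + a * e10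
    subst hw hx
    have hy : y = 0 := by
      apply mul_left_cancel₀ hb
      linear_combination y * h + p * e00 - a * q * e10
    have hz : z = 0 := by
      apply mul_left_cancel₀ hb
      linear_combination z * h + p * e10 - q * e00
    subst hy hz
    rfl
  have hfin : Module.finrank F ℍ[F, a, b] = Module.finrank F (Matrix (Fin 2) (Fin 2) F) := by
    rw [QuaternionAlgebra.finrank_eq_four, Module.finrank_matrix]
    simp
  have hsurj : Function.Surjective B.liftHom :=
    (LinearMap.injective_iff_surjective_of_finrank_eq_finrank (f := B.liftHom.toLinearMap)
      hfin).1 hinj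
  exact ⟨AlgEquiv.ofBijective B.liftHom ⟨hinj, hsurj⟩⟩

/-- If `ℍ[F, a, b]` is split then `b` is a norm from `F(√a)`. -/
theorem QuaternionAlgebra.exists_eq_sq_sub_mul_sq (h2 : (2 : F) ≠ 0) {a b : F} (ha : a ≠ 0)
    (h : Nonempty (ℍ[F, a, b] ≃ₐ[F] Matrix (Fin 2) (Fin 2) F)) :
    ∃ p q : F, b = p ^ 2 - a * q ^ 2 := by
  obtain ⟨e⟩ := h
  have of_sq : ∀ s t : F, t ≠ 0 → s ^ 2 = a * t ^ 2 → ∃ p q : F, b = p ^ 2 - a * q ^ 2 := by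
    intro s t ht hst
    have hs : s ≠ 0 := by
      rintro rfl
      simp [ha, ht] at hst
    exact exists_eq_sq_sub_mul_sq_of_isotropic h2 (x := t) (y := 0) hs
      (by linear_combination -hst)
  obtain ⟨f, g, hf, hg, hfg⟩ : ∃ f g : ℍ[F, a, b], f ≠ 0 ∧ g ≠ 0 ∧ f * g = 0 := by
    refine ⟨e.symm !![1, 0; 0, 0], e.symm !![0, 0; 0, 1], ?_, ?_, ?_⟩
    · rw [Ne, EmbeddingLike.map_eq_zero_iff]
      intro h0
      simpa using congrFun (congrFun h0 0) 0
    · rw [Ne, EmbeddingLike.map_eq_zero_iff]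
      intro h0
      simpa using congrFun (congrFun h0 1) 1
    · rw [← map_mul, EmbeddingLike.map_eq_zero_iff]
      ext i j; fin_cases i <;> fin_cases j <;> simp
  have hN : (star f * f).re = 0 := by
    by_contra hne
    apply hg
    have h0 : star f * f * g = 0 := by rw [mul_assoc, hfg, mul_zero]
    rw [QuaternionAlgebra.star_mul_eq_coe, QuaternionAlgebra.coe_mul_eq_smul] at h0
    exact (smul_eq_zero.1 h0).resolve_left hne
  obtain ⟨p, q, r, s⟩ := f
  simp at hN
  by_cases hD : r ^ 2 - a * s ^ 2 = 0
  · by_cases hs : s = 0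
    · have hr : r = 0 := by simpa [hs] using hD
      subst hs hr
      have hq : q ≠ 0 := by
        rintro rfl
        have hp : p = 0 := by simpa using hN
        subst hp
        exact hf rfl
      exact of_sq p q hq (by linear_combination hN)
    · exact of_sq r s hs (by linear_combination hD)
  · refine ⟨(p * r + a * q * s) / (r ^ 2 - a * s ^ 2), (p * s + q * r) / (r ^ 2 - a * s ^ 2), ?_⟩
    field_simp
    linear_combination (-(r ^ 2 - a * s ^ 2)) * hN

/-- Being a norm from `F(√a)` depends only on the square class of `a`. -/
theorem exists_eq_sq_sub_mul_sq_mul_sq_iff {a b c : F} (hc : c ≠ 0) :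
    (∃ p q : F, b = p ^ 2 - a * c ^ 2 * q ^ 2) ↔ ∃ p q : F, b = p ^ 2 - a * q ^ 2 := by
  constructor
  · rintro ⟨p, q, h⟩
    exact ⟨p, c * q, by rw [h]; ring⟩
  · rintro ⟨p, q, h⟩
    exact ⟨p, q / c, by rw [h]; field_simp⟩

end Split

/-- An integer congruent to `1` modulo `8` is a square in `ℚ₂`. -/
theorem Padic.exists_sq_eq_intCast {c : ℤ} (hc : c % 8 = 1) :
    ∃ z : ℚ_[2], z ≠ 0 ∧ z ^ 2 = c := by
  have hnorm : ‖(Polynomial.X ^ 2 - Polynomial.C c : Polynomial ℤ).aeval (1 : ℤ_[2])‖ <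
      ‖(Polynomial.X ^ 2 - Polynomial.C c : Polynomial ℤ).derivative.aeval (1 : ℤ_[2])‖ ^ 2 := by
    have h1 : ‖((1 - c : ℤ) : ℤ_[2])‖ ≤ ((2 : ℕ) : ℝ) ^ (-(3 : ℕ) : ℤ) :=
      PadicInt.norm_int_le_pow_iff_dvd.2 (by norm_num; omega)
    have h2 : ‖(2 : ℤ_[2])‖ = 2⁻¹ := by
      simpa using PadicInt.norm_p (p := 2)
    have h3 : (Polynomial.aeval (1 : ℤ_[2])) (2 : Polynomial ℤ) = 2 := map_ofNat _ 2
    simp [h2, h3]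
    push_cast at h1
    refine h1.trans_lt ?_
    norm_num
  obtain ⟨z, hz, -⟩ := hensels_lemma hnorm
  have hz' : z ^ 2 = (c : ℤ_[2]) := by simpa [sub_eq_zero] using hz
  have hz'' : (z : ℚ_[2]) ^ 2 = c := by exact_mod_cast congrArg ((↑) : ℤ_[2] → ℚ_[2]) hz'
  refine ⟨z, ?_, hz''⟩
  intro h0
  rw [h0] at hz''
  have : c = 0 := by
    have : (c : ℚ_[2]) = 0 := by rw [← hz'']; simp
    exact_mod_cast this
  omega

theorem Padic.exists_eq_sq_sub_mul_sq_of_emod_eight {a b x y : ℤ}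
    (h : (a * x ^ 2 + b * y ^ 2) % 8 = 1) :
    ∃ p q : ℚ_[2], (b : ℚ_[2]) = p ^ 2 - a * q ^ 2 := by
  obtain ⟨z, hz, hzc⟩ := Padic.exists_sq_eq_intCast h
  refine exists_eq_sq_sub_mul_sq_of_isotropic two_ne_zero (x := (x : ℚ_[2])) (y := (y : ℚ_[2]))
    hz ?_
  rw [hzc]
  push_cast
  rfl

/-- A zero over `ℚ_p` of an integral ternary form `a * x ^ 2 + b * y ^ 2 - z ^ 2` can be scaled to
a zero modulo `p ^ n` with some coordinate equal to `1`. -/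
theorem Padic.exists_zmod_zero_of_isotropic {p : ℕ} [Fact p.Prime] (n : ℕ) {a b : ℤ}
    {x y z : ℚ_[p]} (hne : x ≠ 0 ∨ y ≠ 0 ∨ z ≠ 0) (h : a * x ^ 2 + b * y ^ 2 = z ^ 2) :
    ∃ x y z : ZMod (p ^ n), (x = 1 ∨ y = 1 ∨ z = 1) ∧ a * x ^ 2 + b * y ^ 2 = z ^ 2 := by
  obtain ⟨m, hm, hx, hy, hz, hmem⟩ : ∃ m : ℚ_[p], m ≠ 0 ∧ ‖x‖ ≤ ‖m‖ ∧ ‖y‖ ≤ ‖m‖ ∧ ‖z‖ ≤ ‖m‖ ∧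
      (x = m ∨ y = m ∨ z = m) := by
    have key : ∃ m : ℚ_[p], ‖x‖ ≤ ‖m‖ ∧ ‖y‖ ≤ ‖m‖ ∧ ‖z‖ ≤ ‖m‖ ∧ (x = m ∨ y = m ∨ z = m) := by
      rcases le_total ‖x‖ ‖y‖ with h1 | h1 <;> rcases le_total ‖y‖ ‖z‖ with h2 | h2 <;>
        rcases le_total ‖x‖ ‖z‖ with h3 | h3
      · exact ⟨z, h3, h2, le_rfl, by simp⟩
      · exact ⟨z, h1.trans h2, h2, le_rfl, by simp⟩
      · exact ⟨y, h1, le_rfl, h2, by simp⟩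
      · exact ⟨y, h1, le_rfl, h2, by simp⟩
      · exact ⟨z, h3, h2, le_rfl, by simp⟩
      · exact ⟨x, le_rfl, h1, h3, by simp⟩
      · exact ⟨x, le_rfl, h1, h2.trans h1, by simp⟩
      · exact ⟨x, le_rfl, h1, h3, by simp⟩
    obtain ⟨m, hx, hy, hz, hmem⟩ := key
    refine ⟨m, ?_, hx, hy, hz, hmem⟩
    rintro rfl
    simp at hx hy hz
    simp [hx, hy, hz] at hne
  have hle : ∀ t : ℚ_[p], ‖t‖ ≤ ‖m‖ → ‖t / m‖ ≤ 1 := fun t ht => by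
    rw [norm_div]
    exact div_le_one_of_le₀ ht (norm_nonneg _)
  let X : ℤ_[p] := ⟨x / m, hle x hx⟩
  let Y : ℤ_[p] := ⟨y / m, hle y hy⟩
  let Z : ℤ_[p] := ⟨z / m, hle z hz⟩
  have hXYZ : a * X ^ 2 + b * Y ^ 2 = Z ^ 2 := by
    apply Subtype.ext
    push_cast
    simp only [X, Y, Z]
    field_simp
    exact h
  have hred := congrArg (PadicInt.toZModPow (p := p) n) hXYZ
  simp only [map_add, map_mul, map_pow, map_intCast] at hred
  refine ⟨_, _, _, ?_, hred⟩
  have one : ∀ T : ℤ_[p], (T : ℚ_[p]) = 1 → PadicInt.toZModPow (p := p) n T = 1 := by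
    intro T hT
    have : T = 1 := Subtype.ext hT
    rw [this, map_one]
  rcases hmem with hm' | hm' | hm'
  · exact Or.inl (one X (by simp [X, hm', hm]))
  · exact Or.inr (Or.inl (one Y (by simp [Y, hm', hm])))
  · exact Or.inr (Or.inr (one Z (by simp [Z, hm', hm])))

theorem Padic.exists_zmod_eight_zero {a b : ℤ}
    (h : ∃ p q : ℚ_[2], (b : ℚ_[2]) = p ^ 2 - a * q ^ 2) :
    ∃ x y z : ZMod 8, (x = 1 ∨ y = 1 ∨ z = 1) ∧ a * x ^ 2 + b * y ^ 2 = z ^ 2 := by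
  obtain ⟨p, q, h⟩ := h
  exact Padic.exists_zmod_zero_of_isotropic (p := 2) 3 (x := q) (y := 1) (z := p) (by simp)
    (by rw [h]; ring)

theorem ZMod.intCast_eight_eq {n r : ℤ} (h : n % 8 = r) : (n : ZMod 8) = r := by
  rw [← h]
  exact (ZMod.intCast_mod n 8).symm

/-- The Hilbert symbol `(u, v)` at `2` for odd `u` and `v`. -/
theorem Padic.exists_eq_sq_sub_odd_mul_sq_iff {u v : ℤ} (hu : u % 2 = 1) (hv : v % 2 = 1) :
    (∃ p q : ℚ_[2], (v : ℚ_[2]) = p ^ 2 - u * q ^ 2) ↔ u % 4 = 1 ∨ v % 4 = 1 := by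
  constructor
  · intro h
    obtain ⟨x, y, z, h1, hxyz⟩ := Padic.exists_zmod_eight_zero h
    by_contra hcon
    have key : ∀ u ∈ ({3, 7} : Finset (ZMod 8)), ∀ v ∈ ({3, 7} : Finset (ZMod 8)),
        ∀ s t : ZMod 8, u + v * s ^ 2 ≠ t ^ 2 ∧ u * s ^ 2 + v ≠ t ^ 2 ∧
          u * s ^ 2 + v * t ^ 2 ≠ 1 := by decide
    have mem : ∀ w : ℤ, w % 4 = 3 → (w : ZMod 8) ∈ ({3, 7} : Finset (ZMod 8)) := by
      intro w hw
      rcases (by omega : w % 8 = 3 ∨ w % 8 = 7) with h | h <;>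
        rw [ZMod.intCast_eight_eq h] <;> decide
    have key' := key _ (mem u (by omega)) _ (mem v (by omega))
    rcases h1 with rfl | rfl | rfl
    · exact (key' y z).1 (by simpa using hxyz)
    · exact (key' x z).2.1 (by simpa using hxyz)
    · exact (key' x y).2.2 (by simpa using hxyz)
  · intro h
    rcases (by omega : u % 8 = 1 ∨ v % 8 = 1 ∨ u % 8 = 5 ∨ v % 8 = 5) with h | h | h | h
    · exact exists_eq_sq_sub_mul_sq_of_emod_eight (x := 1) (y := 0) (by omega)
    · exact exists_eq_sq_sub_mul_sq_of_emod_eight (x := 0) (y := 1) (by omega)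
    · exact exists_eq_sq_sub_mul_sq_of_emod_eight (x := 1) (y := 2) (by omega)
    · exact exists_eq_sq_sub_mul_sq_of_emod_eight (x := 2) (y := 1) (by omega)

/-- The Hilbert symbol `(2 * u, v)` at `2` for odd `u` and `v`. -/
theorem Padic.exists_eq_sq_sub_two_mul_odd_mul_sq_iff {u v : ℤ} (hu : u % 2 = 1)
    (hv : v % 2 = 1) :
    (∃ p q : ℚ_[2], (v : ℚ_[2]) = p ^ 2 - (2 * u : ℤ) * q ^ 2) ↔
      v % 8 = 1 ∨ (2 * u + v) % 8 = 1 := by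
  constructor
  · intro h
    obtain ⟨x, y, z, h1, hxyz⟩ := Padic.exists_zmod_eight_zero h
    by_contra hcon
    have key : ∀ a ∈ ({2, 6} : Finset (ZMod 8)), ∀ v ∈ ({3, 5, 7} : Finset (ZMod 8)),
        a + v ≠ 1 → ∀ s t : ZMod 8, a + v * s ^ 2 ≠ t ^ 2 ∧ a * s ^ 2 + v ≠ t ^ 2 ∧
          a * s ^ 2 + v * t ^ 2 ≠ 1 := by decide
    have mem : ((2 * u : ℤ) : ZMod 8) ∈ ({2, 6} : Finset (ZMod 8)) := by
      rcases (by omega : (2 * u) % 8 = 2 ∨ (2 * u) % 8 = 6) with h | h <;>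
        rw [ZMod.intCast_eight_eq h] <;> decide
    have mem' : (v : ZMod 8) ∈ ({3, 5, 7} : Finset (ZMod 8)) := by
      rcases (by omega : v % 8 = 3 ∨ v % 8 = 5 ∨ v % 8 = 7) with h | h | h <;>
        rw [ZMod.intCast_eight_eq h] <;> decide
    have hne : ((2 * u : ℤ) : ZMod 8) + v ≠ 1 := by
      intro h
      have : (((2 * u + v : ℤ)) : ZMod 8) = ((1 : ℤ) : ZMod 8) := by
        push_cast at h ⊢; exact h
      have := (ZMod.intCast_eq_intCast_iff' _ _ 8).1 this
      omega
    have key' := key _ mem _ mem' hne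
    rcases h1 with rfl | rfl | rfl
    · exact (key' y z).1 (by simpa using hxyz)
    · exact (key' x z).2.1 (by simpa using hxyz)
    · exact (key' x y).2.2 (by simpa using hxyz)
  · rintro (h | h)
    · exact exists_eq_sq_sub_mul_sq_of_emod_eight (x := 0) (y := 1) (by omega)
    · exact exists_eq_sq_sub_mul_sq_of_emod_eight (x := 1) (y := 1) (by omega)

theorem QuaternionAlgebra.nonempty_algEquiv_matrix_padic_two_iff {u v : ℤ} (hu : u % 2 = 1)
    (hv : v % 2 = 1) (k : ℕ) :
    Nonempty (ℍ[ℚ_[2], ((2 ^ k * u : ℤ) : ℚ_[2]), (v : ℚ_[2])] ≃ₐ[ℚ_[2]]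
      Matrix (Fin 2) (Fin 2) ℚ_[2]) ↔
      if Even k then u % 4 = 1 ∨ v % 4 = 1 else v % 8 = 1 ∨ (2 * u + v) % 8 = 1 := by
  have hu0 : u ≠ 0 := by omega
  have hv0 : (v : ℚ_[2]) ≠ 0 := by
    have : v ≠ 0 := by omega
    exact_mod_cast this
  have ha0 : ((2 ^ k * u : ℤ) : ℚ_[2]) ≠ 0 := by
    have : 2 ^ k * u ≠ 0 := by positivity
    exact_mod_cast this
  rw [show Nonempty _ ↔ _ from ⟨QuaternionAlgebra.exists_eq_sq_sub_mul_sq two_ne_zero ha0,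
    QuaternionAlgebra.nonempty_algEquiv_matrix two_ne_zero ha0 hv0⟩]
  obtain ⟨j, rfl | rfl⟩ := k.even_or_odd'
  · have : ((2 ^ (2 * j) * u : ℤ) : ℚ_[2]) = u * (2 ^ j) ^ 2 := by push_cast; ring
    rw [if_pos (even_two_mul j), ← Padic.exists_eq_sq_sub_odd_mul_sq_iff hu hv, this,
      exists_eq_sq_sub_mul_sq_mul_sq_iff (pow_ne_zero j two_ne_zero)]
  · have : ((2 ^ (2 * j + 1) * u : ℤ) : ℚ_[2]) = (2 * u : ℤ) * (2 ^ j) ^ 2 := by push_cast; ring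
    rw [if_neg (by simp), ← Padic.exists_eq_sq_sub_two_mul_odd_mul_sq_iff hu hv, this,
      exists_eq_sq_sub_mul_sq_mul_sq_iff (pow_ne_zero j two_ne_zero)]

/-- Quadratic reciprocity for coprime odd natural numbers as a product formula. -/
theorem jacobiSym.mul_swap {m n : ℕ} (hm : Odd m) (hn : Odd n) (hmn : m.Coprime n) :
    J(m | n) * J(n | m) = if m % 4 = 3 ∧ n % 4 = 3 then -1 else 1 := by
  have hsq : J(n | m) ^ 2 = 1 := jacobiSym.sq_one (by simpa using hmn.symm)
  rw [← jacobiSym.quadratic_reciprocity_if (Nat.odd_iff.1 hm) (Nat.odd_iff.1 hn)]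
  split_ifs
  · linear_combination -hsq
  · linear_combination hsq

/-- Let `a, b ∈ ℤ` be nonzero with `b` odd and `gcd(a, b) = 1`, and
write `a = a₀·a₁` where `a₁ > 0` is the odd part of `|a|` (so `a₀` is `±` a power
of `2`).  Then `J(a | |b|) · J(b | a₁) = h₂ · h∞`, where `J` is the Jacobi symbol,
`h∞ = −1` if `a < 0` and `b < 0` and `h∞ = 1` otherwise, and `h₂ = 1` if
`ℍ[ℚ₂, a, b] ≅ M₂(ℚ₂)` as `ℚ₂`-algebras and `h₂ = −1` otherwise. -/
theorem jacobiSym_mul_eq_hilbert_two_mul_hilbert_infty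
    (a b : ℤ) (ha : a ≠ 0) (hb : b ≠ 0) (hbodd : Odd b) (hab : Int.gcd a b = 1)
    (a₀ a₁ : ℤ) (hfact : a = a₀ * a₁) (ha₁pos : 0 < a₁) (ha₁odd : Odd a₁)
    (ha₀ : ∃ k : ℕ, a₀ = 2 ^ k ∨ a₀ = -(2 ^ k)) :
    J(a | b.natAbs) * J(b | a₁.natAbs) =
      (if Nonempty (ℍ[ℚ_[2], (a : ℚ_[2]), (b : ℚ_[2])] ≃ₐ[ℚ_[2]]
          Matrix (Fin 2) (Fin 2) ℚ_[2]) then (1 : ℤ) else -1) *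
      (if a < 0 ∧ b < 0 then (-1 : ℤ) else 1) := by
  obtain ⟨k, hk⟩ := ha₀
  lift a₁ to ℕ using ha₁pos.le with m
  obtain ⟨n, hn⟩ : ∃ n : ℕ, n = b.natAbs := ⟨_, rfl⟩
  have hm : Odd m := by exact_mod_cast ha₁odd
  have hnodd : Odd n := by rw [hn]; exact Int.natAbs_odd.2 hbodd
  have hmpos : 0 < m := by exact_mod_cast ha₁pos
  have hmn : m.Coprime n := by
    have h1 : Nat.Coprime a.natAbs n := by rw [hn]; exact hab
    refine h1.coprime_dvd_left ?_
    rw [hfact, Int.natAbs_mul]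
    simp
  rw [← hn, Int.natAbs_natCast]
  have hm2 := Nat.odd_iff.1 hm
  have hn2 := Nat.odd_iff.1 hnodd
  have hpow : (0 : ℤ) < 2 ^ k * m := by positivity
  have hswap := jacobiSym.mul_swap hm hnodd hmn
  -- `s` is the sign of `a`, and `t` is the sign of `b`.
  obtain ⟨s, hs, hsa⟩ : ∃ s : ℤ, (s = 1 ∨ s = -1) ∧ a = 2 ^ k * (s * m) := by
    rcases hk with rfl | rfl
    · exact ⟨1, by simp, by rw [hfact]; ring⟩
    · exact ⟨-1, by simp, by rw [hfact]; ring⟩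
  obtain ⟨t, ht, htb⟩ : ∃ t : ℤ, (t = 1 ∨ t = -1) ∧ b = t * n := by
    rcases Int.natAbs_eq b with h | h
    · exact ⟨1, by simp, by rw [hn, one_mul]; exact h⟩
    · exact ⟨-1, by simp, by rw [hn, neg_one_mul]; exact h⟩
  have hL : J(a | n) * J(b | m) = J(2 | n) ^ k * J(s | n) * J(t | m) *
      (if m % 4 = 3 ∧ n % 4 = 3 then -1 else 1) := by
    rw [← hswap, hsa, htb, jacobiSym.mul_left, jacobiSym.mul_left, jacobiSym.mul_left,
      jacobiSym.pow_left]
    ring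
  have hN := QuaternionAlgebra.nonempty_algEquiv_matrix_padic_two_iff (u := s * m) (v := b)
    (by rcases hs with rfl | rfl <;> omega) (Int.odd_iff.1 hbodd) k
  rw [← hsa] at hN
  have hsign : a < 0 ∧ b < 0 ↔ s = -1 ∧ t = -1 := by
    have h1 : a < 0 ↔ s = -1 := by
      rcases hs with rfl | rfl
      · simp only [one_mul] at hsa; omega
      · have : a = -(2 ^ k * m) := by rw [hsa]; ring
        omega
    have h2 : b < 0 ↔ t = -1 := by
      rcases ht with rfl | rfl <;> omega
    rw [h1, h2]
  rw [hL]
  simp only [hN, hsign]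
  subst htb
  clear hN hsign hL hsa hswap
  rw [jacobiSym.at_two hnodd, ZMod.χ₈_nat_eq_if_mod_eight]
  simp only [hn2, one_ne_zero, if_false]
  rcases Nat.even_or_odd k with hk | hk
  · simp only [if_pos hk, ite_pow, one_pow, hk.neg_one_pow, ite_self, one_mul]
    rcases hs with rfl | rfl <;> rcases ht with rfl | rfl <;>
      simp only [jacobiSym.one_left, jacobiSym.at_neg_one hnodd, jacobiSym.at_neg_one hm,
        ZMod.χ₄_nat_eq_if_mod_four, hn2, hm2, one_ne_zero, if_false, true_and, and_true,
        reduceCtorEq, Int.reduceNeg, reduceIte] <;>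
      norm_num <;> split_ifs <;> omega
  · simp only [if_neg (Nat.not_even_iff_odd.2 hk), ite_pow, one_pow, hk.neg_one_pow]
    rcases hs with rfl | rfl <;> rcases ht with rfl | rfl <;>
      simp only [jacobiSym.one_left, jacobiSym.at_neg_one hnodd, jacobiSym.at_neg_one hm,
        ZMod.χ₄_nat_eq_if_mod_four, hn2, hm2, one_ne_zero, if_false, true_and, and_true,
        reduceCtorEq, Int.reduceNeg, reduceIte] <;>
      norm_num <;> split_ifs <;> omega
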